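/- For every n ≥ 4, let v = s_{n-3} = (n−2, n−3) be the simple transposition in S_n, let u = (2,3,…,n−2,1,n,n−1) ∈ S_n and w = (2,3,…,n,1,n−2,n−1) ∈ S_n (in one-line notation). Then c^w_{u,v} = 1 and c^{N∗w}_{N∗u, N∗v} = 0 for all N > 1. -/

import Mathlib

open scoped Classical

/-- `w` lies in (the copy of) `S_n`: it fixes every point `m ≥ n` (0-indexed). -/
def InSymm (n : ℕ) (w : Equiv.Perm ℕ) : Prop := ∀ m, n ≤ m → w m = m

/-- `w ∈ S_∞`: `w` fixes all but finitely many points. -/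
def IsFinPerm (w : Equiv.Perm ℕ) : Prop := ∃ n, InSymm n w

/-- `ℓ(w)`: the number of inversions of `w`. -/
noncomputable def invLen (w : Equiv.Perm ℕ) : ℕ :=
  Set.ncard {p : ℕ × ℕ | p.1 < p.2 ∧ w p.2 < w p.1}

/-- the Lehmer code of `w` (0-indexed): `lCode w i = #{j > i | w j < w i}`. -/
noncomputable def lCode (w : Equiv.Perm ℕ) (i : ℕ) : ℕ :=
  Set.ncard {j | i < j ∧ w j < w i}

/-- the descent set of `w` (0-indexed). -/
def des (w : Equiv.Perm ℕ) : Set ℕ := {i | w (i + 1) < w i}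

/-- the divided difference operator `∂ᵢ f = (f - sᵢ·f)/(xᵢ - xᵢ₊₁)`. -/
noncomputable def divDiff (i : ℕ) (f : MvPolynomial ℕ ℤ) : MvPolynomial ℕ ℤ :=
  if h : ∃ g, f - MvPolynomial.rename (Equiv.swap i (i + 1)) f =
      (MvPolynomial.X i - MvPolynomial.X (i + 1)) * g
  then h.choose else 0

/-- `𝔖_{w₀} = x₁^{n-1} x₂^{n-2} ⋯ x_{n-1}` (with variables 0-indexed). -/
noncomputable def staircase (n : ℕ) : MvPolynomial ℕ ℤ :=
  ∏ i ∈ Finset.range n, (MvPolynomial.X i : MvPolynomial ℕ ℤ) ^ (n - 1 - i)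

/-- Fuelled recursion computing Schubert polynomials inside `S_n`:
`𝔖_w = ∂ᵢ 𝔖_{w·sᵢ}` whenever `w i < w (i+1)`, starting from `𝔖_{w₀} = staircase n`. -/
noncomputable def SchubertAux (n : ℕ) : ℕ → Equiv.Perm ℕ → MvPolynomial ℕ ℤ
  | 0, _ => staircase n
  | (k + 1), w =>
    if h : ∃ i, i + 1 < n ∧ w i < w (i + 1) then
      divDiff h.choose (SchubertAux n k (w * Equiv.swap h.choose (h.choose + 1)))
    else staircase n

/-- the Schubert polynomial `𝔖_w` of `w ∈ S_∞`. -/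
noncomputable def Schubert (w : Equiv.Perm ℕ) : MvPolynomial ℕ ℤ :=
  if h : IsFinPerm w then SchubertAux h.choose (h.choose * h.choose) w else 0

/-- `c` is the family of Schubert coefficients `c^w_{u,v}` for the pair `(u,v)`, i.e. the
(finitely supported, `S_∞`-supported) coefficients with
`𝔖_u · 𝔖_v = Σ_{w ∈ S_∞} c^w_{u,v} 𝔖_w`. -/
def IsSchubertCoeff (u v : Equiv.Perm ℕ) (c : Equiv.Perm ℕ →₀ ℕ) : Prop :=
  (∀ w ∈ c.support, IsFinPerm w) ∧
  Schubert u * Schubert v = c.sum fun w k => (k : MvPolynomial ℕ ℤ) * Schubert w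

/-- `w'` is the code scaling `N ∗ w`: the unique permutation whose Lehmer code is
`N` times the Lehmer code of `w`. -/
def IsCodeScale (N : ℕ) (w w' : Equiv.Perm ℕ) : Prop :=
  IsFinPerm w' ∧ ∀ i, lCode w' i = N * lCode w i

/-- the Rothe diagram of `w` (0-indexed). -/
def rothe (w : Equiv.Perm ℕ) : Set (ℕ × ℕ) := {p | p.2 < w p.1 ∧ p.1 < w.symm p.2}

/-- column `h` of the Rothe diagram of `w`. -/
def rotheCol (w : Equiv.Perm ℕ) (h : ℕ) : Set ℕ := {r | (r, h) ∈ rothe w}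

/-- the shaded columns of `D(w)` with respect to `k`: the columns `w r` for rows `r > k`. -/
def shadedCols (k : ℕ) (w : Equiv.Perm ℕ) : Set ℕ := {j | ∃ r, k < r ∧ w r = j}

/-- the position at which (the copies of) column `j` start after every shaded column
is replaced by `N` adjacent copies of itself. -/
noncomputable def stretchCol (k N : ℕ) (w : Equiv.Perm ℕ) (j : ℕ) : ℕ :=
  Set.ncard {h | h < j ∧ h ∉ shadedCols k w} + N * Set.ncard {h | h < j ∧ h ∈ shadedCols k w}

/-- `w'` is the bit scaling `N ⊗ w` with respect to `k`: the unique permutation in `S_∞`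
whose Rothe diagram is obtained from `D(w)` by replacing each shaded column by `N`
adjacent copies of itself. -/
def IsBitScale (k N : ℕ) (w w' : Equiv.Perm ℕ) : Prop :=
  IsFinPerm w' ∧
  rothe w' = {q | ∃ p ∈ rothe w, ∃ m,
    m < (if p.2 ∈ shadedCols k w then N else 1) ∧ q = (p.1, stretchCol k N w p.2 + m)}

/-- `D(u)` together with a copy of `D(v)` shifted `m` columns to the right. -/
def doubleDiagram (m : ℕ) (u v : Equiv.Perm ℕ) : Set (ℕ × ℕ) :=
  rothe u ∪ {q | ∃ p ∈ rothe v, q = (p.1, p.2 + m)}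

/-- `T` is an indicator tableau in `Tab^w_{u,v}` (for `u, v, w ∈ S_m`, all 0-indexed):
a filling of `D(u) ∪ D(v)` with entries in `{0, …, m-1}` such that the number of entries
equal to `i` is `lCode w i`, entries strictly increase down each column, and every entry
appearing in row `r` is at most `r`. -/
def IsIndicatorTableau (m : ℕ) (u v w : Equiv.Perm ℕ) (T : ℕ × ℕ → ℕ) : Prop :=
  (∀ p ∈ doubleDiagram m u v, T p < m) ∧
  (∀ i < m, Set.ncard {p | p ∈ doubleDiagram m u v ∧ T p = i} = lCode w i) ∧
  (∀ p ∈ doubleDiagram m u v, ∀ q ∈ doubleDiagram m u v, p.2 = q.2 → p.1 < q.1 → T p < T q) ∧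
  (∀ p ∈ doubleDiagram m u v, T p ≤ p.1)

open MvPolynomial

section AdjacentSwaps

lemma swap_succ_mul_comm {i j : ℕ} (hij : i + 1 < j) :
    Equiv.swap i (i + 1) * Equiv.swap j (j + 1) = Equiv.swap j (j + 1) * Equiv.swap i (i + 1) := by
  ext x
  simp only [Equiv.Perm.mul_apply, Equiv.swap_apply_def]
  grind

lemma swap_succ_mul_braid (i : ℕ) :
    Equiv.swap i (i + 1) * (Equiv.swap (i + 1) (i + 2) * Equiv.swap i (i + 1)) =
      Equiv.swap (i + 1) (i + 2) * (Equiv.swap i (i + 1) * Equiv.swap (i + 1) (i + 2)) := by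
  ext x
  simp only [Equiv.Perm.mul_apply, Equiv.swap_apply_def]
  grind

end AdjacentSwaps

section DividedDifference

lemma X_sub_X_succ_ne_zero (i : ℕ) : (X i - X (i + 1) : MvPolynomial ℕ ℤ) ≠ 0 := by
  rw [sub_ne_zero]
  exact fun h => by simpa using X_injective h

lemma X_sub_X_succ_dvd (i : ℕ) (f : MvPolynomial ℕ ℤ) :
    (X i - X (i + 1) : MvPolynomial ℕ ℤ) ∣ f - rename (Equiv.swap i (i + 1)) f := by
  induction f using MvPolynomial.induction_on with
  | C a => simp
  | add p q hp hq =>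
    rw [map_add, add_sub_add_comm]
    exact dvd_add hp hq
  | mul_X p m hp =>
    have hX : (X i - X (i + 1) : MvPolynomial ℕ ℤ) ∣ X m - X (Equiv.swap i (i + 1) m) := by
      rcases eq_or_ne m i with rfl | h1
      · simp
      rcases eq_or_ne m (i + 1) with rfl | h2
      · rw [Equiv.swap_apply_right, dvd_sub_comm]
      · simp [Equiv.swap_apply_of_ne_of_ne h1 h2]
    rw [map_mul, rename_X]
    convert dvd_add (hp.mul_right (X m))
      (hX.mul_left (rename (Equiv.swap i (i + 1)) p)) using 1
    ring

lemma sub_rename_eq_mul_divDiff (i : ℕ) (f : MvPolynomial ℕ ℤ) :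
    f - rename (Equiv.swap i (i + 1)) f = (X i - X (i + 1)) * divDiff i f := by
  have h : ∃ g, f - rename (Equiv.swap i (i + 1)) f = (X i - X (i + 1)) * g :=
    X_sub_X_succ_dvd i f
  rw [divDiff, dif_pos h]
  exact h.choose_spec

lemma divDiff_eq_of_mul_eq {i : ℕ} {f g : MvPolynomial ℕ ℤ}
    (h : f - rename (Equiv.swap i (i + 1)) f = (X i - X (i + 1)) * g) : divDiff i f = g :=
  mul_left_cancel₀ (X_sub_X_succ_ne_zero i) ((sub_rename_eq_mul_divDiff i f).symm.trans h)

lemma rename_eq_sub (i : ℕ) (f : MvPolynomial ℕ ℤ) :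
    rename (Equiv.swap i (i + 1)) f = f - (X i - X (i + 1)) * divDiff i f := by
  linear_combination -sub_rename_eq_mul_divDiff i f

lemma rename_swap_rename_swap (i j : ℕ) (f : MvPolynomial ℕ ℤ) :
    rename (Equiv.swap i j) (rename (Equiv.swap i j) f) = f := by
  rw [rename_rename]
  convert rename_id_apply f
  ext x
  simp

lemma divDiff_add (i : ℕ) (f g : MvPolynomial ℕ ℤ) :
    divDiff i (f + g) = divDiff i f + divDiff i g := by
  apply divDiff_eq_of_mul_eq
  rw [map_add]
  linear_combination sub_rename_eq_mul_divDiff i f + sub_rename_eq_mul_divDiff i g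

lemma divDiff_smul (i : ℕ) (a : ℤ) (f : MvPolynomial ℕ ℤ) :
    divDiff i (a • f) = a • divDiff i f := by
  apply divDiff_eq_of_mul_eq
  rw [map_zsmul, ← smul_sub, sub_rename_eq_mul_divDiff, mul_smul_comm]

/-- The divided difference operator as a linear map. -/
noncomputable def divDiffₗ (i : ℕ) : MvPolynomial ℕ ℤ →ₗ[ℤ] MvPolynomial ℕ ℤ where
  toFun := divDiff i
  map_add' := divDiff_add i
  map_smul' := divDiff_smul i

lemma divDiff_mul (i : ℕ) (f g : MvPolynomial ℕ ℤ) :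
    divDiff i (f * g) = divDiff i f * g + rename (Equiv.swap i (i + 1)) f * divDiff i g := by
  apply divDiff_eq_of_mul_eq
  rw [map_mul]
  linear_combination g * sub_rename_eq_mul_divDiff i f +
    rename (Equiv.swap i (i + 1)) f * sub_rename_eq_mul_divDiff i g

lemma divDiff_eq_zero_of_rename_eq {i : ℕ} {f : MvPolynomial ℕ ℤ}
    (h : rename (Equiv.swap i (i + 1)) f = f) : divDiff i f = 0 :=
  divDiff_eq_of_mul_eq (by rw [h]; ring)

lemma divDiff_C (i : ℕ) (a : ℤ) : divDiff i (C a) = 0 :=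
  divDiff_eq_zero_of_rename_eq (rename_C _ _)

lemma divDiff_sub (i : ℕ) (f g : MvPolynomial ℕ ℤ) :
    divDiff i (f - g) = divDiff i f - divDiff i g := (divDiffₗ i).map_sub f g

lemma divDiff_zero (i : ℕ) : divDiff i 0 = 0 := (divDiffₗ i).map_zero

lemma divDiff_X_self (i : ℕ) : divDiff i (X i) = 1 :=
  divDiff_eq_of_mul_eq (by simp)

lemma divDiff_X_succ (i : ℕ) : divDiff i (X (i + 1)) = -1 :=
  divDiff_eq_of_mul_eq (by simp)

lemma divDiff_X_of_ne {i m : ℕ} (h₁ : m ≠ i) (h₂ : m ≠ i + 1) : divDiff i (X m) = 0 :=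
  divDiff_eq_zero_of_rename_eq (by simp [Equiv.swap_apply_of_ne_of_ne h₁ h₂])

lemma rename_divDiff (i : ℕ) (f : MvPolynomial ℕ ℤ) :
    rename (Equiv.swap i (i + 1)) (divDiff i f) = divDiff i f := by
  have h := congrArg (rename (Equiv.swap i (i + 1))) (sub_rename_eq_mul_divDiff i f)
  simp only [map_sub, map_mul, rename_swap_rename_swap, rename_X, Equiv.swap_apply_left,
    Equiv.swap_apply_right] at h
  apply mul_left_cancel₀ (X_sub_X_succ_ne_zero i)
  linear_combination h + sub_rename_eq_mul_divDiff i f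

lemma divDiff_divDiff (i : ℕ) (f : MvPolynomial ℕ ℤ) : divDiff i (divDiff i f) = 0 :=
  divDiff_eq_zero_of_rename_eq (rename_divDiff i f)

lemma divDiff_comm {i j : ℕ} (hij : i + 1 < j) (f : MvPolynomial ℕ ℤ) :
    divDiff i (divDiff j f) = divDiff j (divDiff i f) := by
  have hcomm : rename (Equiv.swap i (i + 1)) (rename (Equiv.swap j (j + 1)) f) =
      rename (Equiv.swap j (j + 1)) (rename (Equiv.swap i (i + 1)) f) := by
    simpa only [rename_rename, Equiv.Perm.coe_mul] using
      congrArg (fun σ : Equiv.Perm ℕ => rename σ f) (swap_succ_mul_comm hij)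
  have hi := sub_rename_eq_mul_divDiff i f
  have hj := sub_rename_eq_mul_divDiff j f
  have hij' := sub_rename_eq_mul_divDiff i (divDiff j f)
  have hji' := sub_rename_eq_mul_divDiff j (divDiff i f)
  have hi' := congrArg (rename (Equiv.swap j (j + 1))) hi
  have hj' := congrArg (rename (Equiv.swap i (i + 1))) hj
  simp only [map_sub, map_mul, rename_X] at hi' hj'
  rw [Equiv.swap_apply_of_ne_of_ne (by omega) (by omega),
    Equiv.swap_apply_of_ne_of_ne (by omega) (by omega)] at hi' hj'
  apply mul_left_cancel₀ (X_sub_X_succ_ne_zero i)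
  apply mul_left_cancel₀ (X_sub_X_succ_ne_zero j)
  linear_combination -(X j - X (j + 1)) * hij' + (X i - X (i + 1)) * hji' - hj + hj' + hi - hi' +
    hcomm

lemma divDiff_braid (i : ℕ) (f : MvPolynomial ℕ ℤ) :
    divDiff i (divDiff (i + 1) (divDiff i f)) =
      divDiff (i + 1) (divDiff i (divDiff (i + 1) f)) := by
  have hX : (X i - X (i + 2) : MvPolynomial ℕ ℤ) ≠ 0 := by
    rw [sub_ne_zero]
    exact fun h => by simpa using X_injective h
  have hbraid : rename (Equiv.swap i (i + 1)) (rename (Equiv.swap (i + 1) (i + 2))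
      (rename (Equiv.swap i (i + 1)) f)) = rename (Equiv.swap (i + 1) (i + 2))
      (rename (Equiv.swap i (i + 1)) (rename (Equiv.swap (i + 1) (i + 2)) f)) := by
    simpa only [rename_rename, Equiv.Perm.coe_mul] using
      congrArg (fun σ : Equiv.Perm ℕ => rename σ f) (swap_succ_mul_braid i)
  have e1 : Equiv.swap i (i + 1) (i + 2) = i + 2 :=
    Equiv.swap_apply_of_ne_of_ne (by omega) (by omega)
  have e2 : Equiv.swap (i + 1) (i + 2) i = i :=
    Equiv.swap_apply_of_ne_of_ne (by omega) (by omega)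
  have a1 := sub_rename_eq_mul_divDiff i f
  have a2 := sub_rename_eq_mul_divDiff (i + 1) (divDiff i f)
  have a3 := sub_rename_eq_mul_divDiff i (divDiff (i + 1) (divDiff i f))
  have b1 := sub_rename_eq_mul_divDiff (i + 1) f
  have b2 := sub_rename_eq_mul_divDiff i (divDiff (i + 1) f)
  have b3 := sub_rename_eq_mul_divDiff (i + 1) (divDiff i (divDiff (i + 1) f))
  have a1' := congrArg (rename (Equiv.swap (i + 1) (i + 2))) a1
  have b1' := congrArg (rename (Equiv.swap i (i + 1))) b1
  have a2' := congrArg (rename (Equiv.swap i (i + 1))) a2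
  have b2' := congrArg (rename (Equiv.swap (i + 1) (i + 2))) b2
  have a1'' := congrArg (rename (Equiv.swap i (i + 1))) a1'
  have b1'' := congrArg (rename (Equiv.swap (i + 1) (i + 2))) b1'
  simp only [map_sub, map_mul, rename_X, add_assoc, Nat.reduceAdd, Equiv.swap_apply_left,
    Equiv.swap_apply_right, e1, e2, rename_divDiff] at *
  apply mul_left_cancel₀ (X_sub_X_succ_ne_zero i)
  apply mul_left_cancel₀ (X_sub_X_succ_ne_zero (i + 1))
  apply mul_left_cancel₀ hX
  simp only [add_assoc, Nat.reduceAdd]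
  linear_combination -((X i - X (i + 2)) * (X (i + 1) - X (i + 2))) * a3 -
    (X i - X (i + 2)) * a2 + (X (i + 1) - X (i + 2)) * a2' - a1 + a1' - a1'' +
    (X i - X (i + 2)) * (X i - X (i + 1)) * b3 + (X i - X (i + 2)) * b2 -
    (X i - X (i + 1)) * b2' + b1 - b1' + b1'' - hbraid

lemma divDiff_eq_zero_of_isHomogeneous_zero (i : ℕ) {f : MvPolynomial ℕ ℤ}
    (hf : f.IsHomogeneous 0) : divDiff i f = 0 := by
  rw [← totalDegree_zero_iff_isHomogeneous, totalDegree_eq_zero_iff_eq_C] at hf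
  rw [hf, divDiff_C]

lemma isHomogeneous_divDiff (i d : ℕ) (f : MvPolynomial ℕ ℤ) (hf : f.IsHomogeneous (d + 1)) :
    (divDiff i f).IsHomogeneous d := by
  have one : ∀ p : MvPolynomial ℕ ℤ, p.IsHomogeneous 1 → (divDiff i p).IsHomogeneous 0 := by
    intro p hp
    rw [← mem_homogeneousSubmodule, homogeneousSubmodule_one_eq_span_X] at hp
    induction hp using Submodule.span_induction with
    | mem x h =>
      obtain ⟨m, rfl⟩ := h
      rcases eq_or_ne m i with rfl | h1
      · rw [divDiff_X_self]
        exact isHomogeneous_one ..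
      rcases eq_or_ne m (i + 1) with rfl | h2
      · rw [divDiff_X_succ]
        exact (isHomogeneous_one ..).neg
      · rw [divDiff_X_of_ne h1 h2]
        exact isHomogeneous_zero ..
    | zero =>
      rw [divDiff_zero]
      exact isHomogeneous_zero ..
    | add x y _ _ hx hy =>
      rw [divDiff_add]
      exact hx.add hy
    | smul a x _ hx =>
      rw [divDiff_smul]
      exact (homogeneousSubmodule ℕ ℤ 0).smul_mem a hx
  induction d generalizing f with
  | zero => exact one f hf
  | succ d ih =>
    rw [← mem_homogeneousSubmodule, ← homogeneousSubmodule_one_pow, pow_succ',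
      homogeneousSubmodule_one_pow] at hf
    induction hf using Submodule.mul_induction_on' with
    | mem_mul_mem p hp q hq =>
      rw [divDiff_mul]
      have h₁ := (one p hp).mul hq
      have h₂ := ((hp.rename_isHomogeneous : (rename (Equiv.swap i (i + 1)) p).IsHomogeneous 1)).mul
        (ih q hq)
      rw [zero_add] at h₁
      rw [add_comm 1 d] at h₂
      exact h₁.add h₂
    | add x _ y _ hx hy =>
      rw [divDiff_add]
      exact hx.add hy

end DividedDifference

section FinitePermutations

lemma InSymm.mono {m n : ℕ} (hmn : m ≤ n) {w : Equiv.Perm ℕ} (hw : InSymm m w) : InSymm n w :=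
  fun x hx => hw x (hmn.trans hx)

lemma InSymm.lt {n : ℕ} {w : Equiv.Perm ℕ} (hw : InSymm n w) {x : ℕ} (hx : x < n) : w x < n := by
  by_contra! h
  have := w.injective (hw _ h)
  omega

lemma InSymm.mul {n : ℕ} {u v : Equiv.Perm ℕ} (hu : InSymm n u) (hv : InSymm n v) :
    InSymm n (u * v) := fun x hx => by rw [Equiv.Perm.mul_apply, hv x hx, hu x hx]

lemma inSymm_swap {n i j : ℕ} (hi : i < n) (hj : j < n) : InSymm n (Equiv.swap i j) :=
  fun _ hx => Equiv.swap_apply_of_ne_of_ne (by omega) (by omega)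

lemma IsFinPerm.mul_swap {w : Equiv.Perm ℕ} (hw : IsFinPerm w) (i j : ℕ) :
    IsFinPerm (w * Equiv.swap i j) := by
  obtain ⟨n, hn⟩ := hw
  exact ⟨max n (max (i + 1) (j + 1)),
    (hn.mono (by omega)).mul (inSymm_swap (by omega) (by omega))⟩

lemma isFinPerm_one : IsFinPerm 1 := ⟨0, fun _ _ => rfl⟩

lemma InSymm.inversions_subset {n : ℕ} {w : Equiv.Perm ℕ} (hw : InSymm n w) :
    {p : ℕ × ℕ | p.1 < p.2 ∧ w p.2 < w p.1} ⊆ (Finset.range n ×ˢ Finset.range n : Finset _) := by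
  rintro ⟨a, b⟩ ⟨hab, hw'⟩
  have hb : b < n := by
    by_contra! hb
    simp only at hab hw'
    rw [hw b hb] at hw'
    rcases lt_or_ge a n with h | h
    · have := hw.lt h
      omega
    · rw [hw a h] at hw'
      omega
  simp only at hab
  simp only [Finset.coe_product, Finset.coe_range, Set.mem_prod, Set.mem_Iio]
  omega

lemma IsFinPerm.finite_inversions {w : Equiv.Perm ℕ} (hw : IsFinPerm w) :
    {p : ℕ × ℕ | p.1 < p.2 ∧ w p.2 < w p.1}.Finite := by
  obtain ⟨n, hn⟩ := hw
  exact (Finset.finite_toSet _).subset hn.inversions_subset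

lemma InSymm.invLen_le {n : ℕ} {w : Equiv.Perm ℕ} (hw : InSymm n w) : invLen w ≤ n * n := by
  have h := Set.ncard_le_ncard hw.inversions_subset
  rwa [Set.ncard_coe_finset, Finset.card_product, Finset.card_range] at h

lemma invLen_mul_swap_lt {w : Equiv.Perm ℕ} (hw : IsFinPerm w) {j : ℕ} (hj : w (j + 1) < w j) :
    invLen (w * Equiv.swap j (j + 1)) < invLen w := by
  set s := Equiv.swap j (j + 1) with hs
  have key : Set.image (Prod.map s s)
      {p : ℕ × ℕ | p.1 < p.2 ∧ (w * s) p.2 < (w * s) p.1} ⊂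
      {p : ℕ × ℕ | p.1 < p.2 ∧ w p.2 < w p.1} := by
    have hlt : ∀ a b, a < b → (w * s) b < (w * s) a → s a < s b ∧ (s a, s b) ≠ (j, j + 1) := by
      intro a b hab h
      have : ¬ (a = j ∧ b = j + 1) := by
        rintro ⟨rfl, rfl⟩
        simp [hs] at h
        omega
      simp only [hs, Equiv.swap_apply_def, ne_eq, Prod.mk.injEq]
      grind
    rw [Set.ssubset_iff_of_subset]
    · refine ⟨(j, j + 1), ⟨by simp, hj⟩, ?_⟩
      rintro ⟨⟨a, b⟩, ⟨hab, h⟩, he⟩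
      exact (hlt a b hab h).2 he
    · rintro _ ⟨⟨a, b⟩, ⟨hab, h⟩, rfl⟩
      exact ⟨(hlt a b hab h).1, h⟩
  have h := Set.ncard_lt_ncard key hw.finite_inversions
  rwa [Set.ncard_image_of_injective _ (s.injective.prodMap s.injective)] at h

lemma eq_one_of_forall_lt_succ {w : Equiv.Perm ℕ} (h : ∀ j, w j < w (j + 1)) : w = 1 := by
  have hw : StrictMono w := strictMono_nat_of_lt_succ h
  have hw' : StrictMono w.symm := fun a b hab => by
    rw [← hw.lt_iff_lt]
    simpa using hab
  ext x
  refine le_antisymm ?_ (hw.id_le x)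
  simpa using hw'.id_le (w x)

lemma exists_descent {w : Equiv.Perm ℕ} (h : w ≠ 1) : ∃ j, w (j + 1) < w j := by
  by_contra! H
  exact h (eq_one_of_forall_lt_succ fun j =>
    (H j).lt_of_ne fun e => by simpa using w.injective e)

lemma not_descent_iff {w : Equiv.Perm ℕ} {j : ℕ} : ¬ w (j + 1) < w j ↔ w j < w (j + 1) := by
  rw [not_lt]
  exact ⟨fun h => h.lt_of_ne fun e => by simpa using w.injective e, le_of_lt⟩

/-- Induction on finite permutations along descents. -/
lemma IsFinPerm.descent_induction {P : ∀ w, IsFinPerm w → Prop} (one : P 1 isFinPerm_one)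
    (step : ∀ w (hw : IsFinPerm w) j, w (j + 1) < w j →
      P (w * Equiv.swap j (j + 1)) (hw.mul_swap j (j + 1)) → P w hw)
    {w : Equiv.Perm ℕ} (hw : IsFinPerm w) : P w hw := by
  induction h : invLen w using Nat.strong_induction_on generalizing w with
  | _ k ih =>
    by_cases h1 : w = 1
    · subst h1
      exact one
    obtain ⟨j, hj⟩ := exists_descent h1
    exact step w hw j hj (ih _ (h ▸ invLen_mul_swap_lt hw hj) (hw.mul_swap _ _) rfl)

end FinitePermutations

section DescentFamily

variable {M : Type*}

/-- The family `w ↦ D_{j₁} ⋯ D_{jₗ} m₀` for a decomposition `w = s_{jₗ} ⋯ s_{j₁}` obtained by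
successively removing descents. -/
noncomputable def descentFamily (D : ℕ → M → M) (m₀ : M) (w : Equiv.Perm ℕ) : M :=
  if h : IsFinPerm w ∧ ∃ j, w (j + 1) < w j then
    D h.2.choose (descentFamily D m₀ (w * Equiv.swap h.2.choose (h.2.choose + 1)))
  else m₀
termination_by invLen w
decreasing_by exact invLen_mul_swap_lt h.1 h.2.choose_spec

lemma descentFamily_one (D : ℕ → M → M) (m₀ : M) : descentFamily D m₀ 1 = m₀ := by
  rw [descentFamily, dif_neg]
  simp

lemma descentFamily_induction {D : ℕ → M → M} {m₀ : M} {P : M → Prop} (base : P m₀)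
    (step : ∀ j m, P m → P (D j m)) (w : Equiv.Perm ℕ) : P (descentFamily D m₀ w) := by
  induction h : invLen w using Nat.strong_induction_on generalizing w with
  | _ k ih =>
    rw [descentFamily]
    split_ifs with h1
    · exact step _ _ (ih _ (h ▸ invLen_mul_swap_lt h1.1 h1.2.choose_spec) _ rfl)
    · exact base

theorem descentFamily_eq {D : ℕ → M → M}
    (hcomm : ∀ i j, i + 1 < j → ∀ m, D i (D j m) = D j (D i m))
    (hbraid : ∀ i m, D i (D (i + 1) (D i m)) = D (i + 1) (D i (D (i + 1) m))) (m₀ : M)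
    {w : Equiv.Perm ℕ} (hw : IsFinPerm w) {j : ℕ} (hj : w (j + 1) < w j) :
    descentFamily D m₀ w = D j (descentFamily D m₀ (w * Equiv.swap j (j + 1))) := by
  induction h : invLen w using Nat.strong_induction_on generalizing w j with
  | _ k ih =>
    subst h
    have diamond : ∀ a b, a < b → w (a + 1) < w a → w (b + 1) < w b →
        D a (descentFamily D m₀ (w * Equiv.swap a (a + 1))) =
          D b (descentFamily D m₀ (w * Equiv.swap b (b + 1))) := by
      intro a b hab ha hb
      have la := invLen_mul_swap_lt hw ha
      have lb := invLen_mul_swap_lt hw hb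
      have fa := hw.mul_swap a (a + 1)
      have fb := hw.mul_swap b (b + 1)
      rcases (Nat.succ_le_of_lt hab).eq_or_lt with rfl | hab'
      · simp only [Nat.succ_eq_add_one, add_assoc, Nat.reduceAdd] at *
        have e1 : Equiv.swap a (a + 1) (a + 2) = a + 2 :=
          Equiv.swap_apply_of_ne_of_ne (by omega) (by omega)
        have e2 : Equiv.swap (a + 1) (a + 2) a = a :=
          Equiv.swap_apply_of_ne_of_ne (by omega) (by omega)
        have da : (w * Equiv.swap a (a + 1)) (a + 1 + 1) < (w * Equiv.swap a (a + 1)) (a + 1) := by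
          simp [add_assoc, e1]
          omega
        have db : (w * Equiv.swap (a + 1) (a + 2)) (a + 1) < (w * Equiv.swap (a + 1) (a + 2)) a := by
          simp [e2]
          omega
        have la' := invLen_mul_swap_lt fa da
        have lb' := invLen_mul_swap_lt fb db
        have da' : (w * Equiv.swap a (a + 1) * Equiv.swap (a + 1) (a + 1 + 1)) (a + 1) <
            (w * Equiv.swap a (a + 1) * Equiv.swap (a + 1) (a + 1 + 1)) a := by
          simp [add_assoc, e1, e2]
          omega
        have db' : (w * Equiv.swap (a + 1) (a + 2) * Equiv.swap a (a + 1)) (a + 1 + 1) <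
            (w * Equiv.swap (a + 1) (a + 2) * Equiv.swap a (a + 1)) (a + 1) := by
          simp [add_assoc, e1, e2]
          omega
        rw [ih _ la fa da rfl, ih _ (la'.trans la) (fa.mul_swap _ _) da' rfl,
          ih _ lb fb db rfl, ih _ (lb'.trans lb) (fb.mul_swap _ _) db' rfl, hbraid]
        simp only [mul_assoc, add_assoc, Nat.reduceAdd, swap_succ_mul_braid]
      · have hab'' : a + 1 < b := hab'
        have da : (w * Equiv.swap a (a + 1)) (b + 1) < (w * Equiv.swap a (a + 1)) b := by
          simpa [Equiv.swap_apply_of_ne_of_ne (show b + 1 ≠ a by omega) (show b + 1 ≠ a + 1 by omega),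
            Equiv.swap_apply_of_ne_of_ne (show b ≠ a by omega) (show b ≠ a + 1 by omega)] using hb
        have db : (w * Equiv.swap b (b + 1)) (a + 1) < (w * Equiv.swap b (b + 1)) a := by
          simpa [Equiv.swap_apply_of_ne_of_ne (show a + 1 ≠ b by omega) (show a + 1 ≠ b + 1 by omega),
            Equiv.swap_apply_of_ne_of_ne (show a ≠ b by omega) (show a ≠ b + 1 by omega)] using ha
        rw [ih _ la fa da rfl, ih _ lb fb db rfl, hcomm a b hab'', mul_assoc, mul_assoc,
          swap_succ_mul_comm hab'']
    have hex : IsFinPerm w ∧ ∃ j, w (j + 1) < w j := ⟨hw, j, hj⟩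
    rw [descentFamily, dif_pos hex]
    have hspec := hex.2.choose_spec
    rcases lt_trichotomy hex.2.choose j with hlt | heq | hgt
    · exact diamond _ _ hlt hspec hj
    · rw [heq]
    · exact (diamond _ _ hgt hj hspec).symm

end DescentFamily

section SchubertPolynomials

/-- The permutation of `ℕ` reversing `{0, …, n - 1}` and fixing every other point. -/
def reversal (n : ℕ) : Equiv.Perm ℕ where
  toFun x := if x < n then n - 1 - x else x
  invFun x := if x < n then n - 1 - x else x
  left_inv x := by grind
  right_inv x := by grind

lemma reversal_apply (n x : ℕ) : reversal n x = if x < n then n - 1 - x else x := rfl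

lemma inSymm_reversal (n : ℕ) : InSymm n (reversal n) := fun x hx => by
  simp [reversal_apply, hx]

lemma reversal_mul_reversal (n : ℕ) : reversal n * reversal n = 1 := by
  ext x
  simp only [Equiv.Perm.mul_apply, reversal_apply, Equiv.Perm.one_apply]
  grind

lemma reversal_lt_reversal_iff {n : ℕ} {x y : ℕ} (hx : x < n) (hy : y < n) :
    reversal n x < reversal n y ↔ y < x := by
  simp only [reversal_apply, hx, hy, if_true]
  omega

/-- The Schubert polynomial of `w ∈ S_n`, computed inside `S_n`. -/
noncomputable def levelSchubert (n : ℕ) (w : Equiv.Perm ℕ) : MvPolynomial ℕ ℤ :=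
  descentFamily divDiff (staircase n) (reversal n * w)

lemma levelSchubert_of_ascent {n : ℕ} {w : Equiv.Perm ℕ} (hw : InSymm n w) {j : ℕ}
    (hjn : j + 1 < n) (hj : w j < w (j + 1)) :
    levelSchubert n w = divDiff j (levelSchubert n (w * Equiv.swap j (j + 1))) := by
  rw [levelSchubert, levelSchubert, ← mul_assoc]
  refine descentFamily_eq (fun i j hij => divDiff_comm hij) divDiff_braid _
    ⟨n, (inSymm_reversal n).mul hw⟩ ?_
  rwa [Equiv.Perm.mul_apply, Equiv.Perm.mul_apply,
    reversal_lt_reversal_iff (hw.lt hjn) (hw.lt (by omega))]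

lemma reversal_mul_eq_one_of_forall_lt {n : ℕ} {w : Equiv.Perm ℕ} (hw : InSymm n w)
    (h : ∀ i, i + 1 < n → w (i + 1) < w i) : reversal n * w = 1 := by
  apply eq_one_of_forall_lt_succ
  intro i
  have hv := (inSymm_reversal n).mul hw
  rcases lt_or_ge (i + 1) n with hi | hi
  · rw [Equiv.Perm.mul_apply, Equiv.Perm.mul_apply,
      reversal_lt_reversal_iff (hw.lt (by omega)) (hw.lt hi)]
    exact h i hi
  · rw [hv (i + 1) hi]
    rcases lt_or_ge i n with hi' | hi'
    · exact (hv.lt hi').trans_le hi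
    · rw [hv i hi']
      exact Nat.lt_succ_self i

lemma schubertAux_eq_levelSchubert {n k : ℕ} {w : Equiv.Perm ℕ} (hw : InSymm n w)
    (hk : invLen (reversal n * w) ≤ k) : SchubertAux n k w = levelSchubert n w := by
  have hfin : IsFinPerm (reversal n * w) := ⟨n, (inSymm_reversal n).mul hw⟩
  have base : (∀ j, ¬ (reversal n * w) (j + 1) < (reversal n * w) j) →
      staircase n = levelSchubert n w := by
    intro h
    rw [levelSchubert, eq_one_of_forall_lt_succ fun j => not_descent_iff.1 (h j),
      descentFamily_one]
  induction k generalizing w with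
  | zero => exact base fun j hj => by have := invLen_mul_swap_lt hfin hj; omega
  | succ k ih =>
    rw [SchubertAux]
    split_ifs with h
    · obtain ⟨hn, hlt⟩ := h.choose_spec
      have hdes : (reversal n * w) (h.choose + 1) < (reversal n * w) h.choose := by
        rwa [Equiv.Perm.mul_apply, Equiv.Perm.mul_apply,
          reversal_lt_reversal_iff (hw.lt hn) (hw.lt (by omega))]
      have hlen := invLen_mul_swap_lt hfin hdes
      have hw' : InSymm n (w * Equiv.swap h.choose (h.choose + 1)) :=
        hw.mul (inSymm_swap (by omega) hn)
      rw [levelSchubert_of_ascent hw hn hlt, ih hw' (by rw [← mul_assoc]; omega)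
        ⟨n, (inSymm_reversal n).mul hw'⟩]
      intro hno
      rw [levelSchubert, eq_one_of_forall_lt_succ fun j => not_descent_iff.1 (hno j),
        descentFamily_one]
    · push Not at h
      rw [levelSchubert, reversal_mul_eq_one_of_forall_lt hw, descentFamily_one]
      exact fun i hi => (h i hi).lt_of_ne fun e => by simpa using w.injective e

/-- The product of adjacent swaps `s_0 s_1 ⋯ s_{k-1}`. -/
def swapChain : ℕ → Equiv.Perm ℕ
  | 0 => 1
  | k + 1 => swapChain k * Equiv.swap k (k + 1)

lemma swapChain_apply (k x : ℕ) :
    swapChain k x = if x < k then x + 1 else if x = k then 0 else x := by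
  induction k generalizing x with
  | zero => simp [swapChain]
  | succ k ih =>
    rw [swapChain, Equiv.Perm.mul_apply, ih, Equiv.swap_apply_def]
    grind

lemma inSymm_swapChain (k : ℕ) : InSymm (k + 1) (swapChain k) := fun x hx => by
  rw [swapChain_apply]
  grind

lemma descentFamily_swapChain {n k : ℕ} (hk : k ≤ n) :
    descentFamily divDiff (staircase (n + 1)) (swapChain k) =
      ∏ i ∈ Finset.range (n + 1), X i ^ (if i < k then n - 1 - i else n - i) := by
  induction k with
  | zero =>
    rw [swapChain, descentFamily_one, staircase]
    simp
  | succ k ih =>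
    have hdes : swapChain (k + 1) (k + 1) < swapChain (k + 1) k := by
      simp [swapChain_apply]
    rw [descentFamily_eq (fun i j hij => divDiff_comm hij) divDiff_braid _
      ⟨_, inSymm_swapChain _⟩ hdes]
    have hcancel : swapChain (k + 1) * Equiv.swap k (k + 1) = swapChain k := by
      rw [swapChain, mul_assoc, Equiv.swap_mul_self, mul_one]
    rw [hcancel, ih (by omega)]
    set P : MvPolynomial ℕ ℤ :=
      ∏ i ∈ Finset.range (n + 1), X i ^ (if i < k + 1 then n - 1 - i else n - i) with hP
    have hsymm : rename (Equiv.swap k (k + 1)) P = P := by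
      rw [hP, map_prod]
      simp only [map_pow, rename_X]
      refine Finset.prod_nbij' (Equiv.swap k (k + 1)) (Equiv.swap k (k + 1)) ?_ ?_ ?_ ?_ ?_
      · intro i hi
        simp only [Finset.mem_range, Equiv.swap_apply_def] at *
        grind
      · intro i hi
        simp only [Finset.mem_range, Equiv.swap_apply_def] at *
        grind
      · simp
      · simp
      · intro i hi
        congr 1
        simp only [Finset.mem_range, Equiv.swap_apply_def] at *
        grind
    have hfactor : ∏ i ∈ Finset.range (n + 1),
        (X i : MvPolynomial ℕ ℤ) ^ (if i < k then n - 1 - i else n - i) = X k * P := by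
      have hkm : k ∈ Finset.range (n + 1) := by
        rw [Finset.mem_range]
        omega
      rw [hP, ← Finset.mul_prod_erase _ _ hkm, ← Finset.mul_prod_erase _ _ hkm, ← mul_assoc,
        if_neg (lt_irrefl k), if_pos (Nat.lt_succ_self k), ← pow_succ']
      congr 1
      · congr 1
        omega
      · refine Finset.prod_congr rfl fun i hi => ?_
        rw [Finset.mem_erase] at hi
        congr 1
        grind
    rw [hfactor, divDiff_mul, divDiff_X_self, divDiff_eq_zero_of_rename_eq hsymm, one_mul,
      mul_zero, add_zero]

lemma levelSchubert_succ {n : ℕ} {w : Equiv.Perm ℕ} (hw : InSymm n w) :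
    levelSchubert (n + 1) w = levelSchubert n w := by
  have hfin : IsFinPerm (reversal n * w) := ⟨n, (inSymm_reversal n).mul hw⟩
  generalize hv : reversal n * w = v at hfin
  have hwv : w = reversal n * v := by rw [← hv, ← mul_assoc, reversal_mul_reversal, one_mul]
  induction hfin using IsFinPerm.descent_induction generalizing w with
  | one =>
    have hchain : reversal (n + 1) * reversal n = swapChain n := by
      ext x
      rw [Equiv.Perm.mul_apply, reversal_apply, reversal_apply, swapChain_apply]
      grind
    rw [levelSchubert, levelSchubert, hv, hwv, mul_one, hchain, descentFamily_one,
      descentFamily_swapChain le_rfl, staircase, Finset.prod_range_succ, if_neg (lt_irrefl n),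
      Nat.sub_self, pow_zero, mul_one]
    exact Finset.prod_congr rfl fun i hi => by rw [if_pos (Finset.mem_range.1 hi)]
  | step v hfin j hj ih =>
    have hvn : InSymm n v := hv ▸ (inSymm_reversal n).mul hw
    have hjn : j + 1 < n := by
      by_contra! h
      rw [hvn _ h] at hj
      rcases lt_or_ge j n with h' | h'
      · have := hvn.lt h'
        omega
      · rw [hvn _ h'] at hj
        omega
    have hasc : w j < w (j + 1) := by
      rw [← hv, Equiv.Perm.mul_apply, Equiv.Perm.mul_apply,
        reversal_lt_reversal_iff (hw.lt hjn) (hw.lt (by omega))] at hj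
      exact hj
    rw [levelSchubert_of_ascent hw hjn hasc,
      levelSchubert_of_ascent (hw.mono n.le_succ) (by omega) hasc,
      ih (hw.mul (inSymm_swap (by omega) hjn)) (by rw [← mul_assoc, hv])
        (by rw [hwv, mul_assoc])]

lemma schubert_eq_levelSchubert {n : ℕ} {w : Equiv.Perm ℕ} (hw : InSymm n w) :
    Schubert w = levelSchubert n w := by
  have stable : ∀ m d, InSymm m w → levelSchubert (m + d) w = levelSchubert m w := by
    intro m d hm
    induction d with
    | zero => rfl
    | succ d ih => rw [← add_assoc, levelSchubert_succ (hm.mono (by omega)), ih]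
  have h : IsFinPerm w := ⟨n, hw⟩
  rw [Schubert, dif_pos h, schubertAux_eq_levelSchubert h.choose_spec
    ((inSymm_reversal _).mul h.choose_spec).invLen_le, ← stable _ n h.choose_spec, add_comm,
    stable _ _ hw]

lemma schubert_one : Schubert 1 = 1 := by
  rw [schubert_eq_levelSchubert (n := 0) fun _ _ => rfl, levelSchubert,
    reversal_mul_eq_one_of_forall_lt (fun _ _ => rfl) (by simp), descentFamily_one]
  simp [staircase]

lemma schubert_of_ascent {w : Equiv.Perm ℕ} (hw : IsFinPerm w) {j : ℕ} (hj : w j < w (j + 1)) :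
    Schubert w = divDiff j (Schubert (w * Equiv.swap j (j + 1))) := by
  obtain ⟨m, hm⟩ := hw
  have hn : InSymm (max m (j + 2)) w := hm.mono (le_max_left _ _)
  rw [schubert_eq_levelSchubert hn, schubert_eq_levelSchubert
    (hn.mul (inSymm_swap (by omega) (by omega))), levelSchubert_of_ascent hn (by omega) hj]

lemma divDiff_schubert_of_ascent {w : Equiv.Perm ℕ} (hw : IsFinPerm w) {j : ℕ}
    (hj : w j < w (j + 1)) : divDiff j (Schubert w) = 0 := by
  rw [schubert_of_ascent hw hj, divDiff_divDiff]

lemma divDiff_schubert_of_descent {w : Equiv.Perm ℕ} (hw : IsFinPerm w) {j : ℕ}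
    (hj : w (j + 1) < w j) : divDiff j (Schubert w) = Schubert (w * Equiv.swap j (j + 1)) := by
  rw [schubert_of_ascent (hw.mul_swap _ _) (j := j) (by simpa using hj), mul_assoc,
    Equiv.swap_mul_self, mul_one]

lemma schubert_ne_zero {w : Equiv.Perm ℕ} (hw : IsFinPerm w) : Schubert w ≠ 0 := by
  induction hw using IsFinPerm.descent_induction with
  | one =>
    rw [schubert_one]
    exact one_ne_zero
  | step w hw j hj ih =>
    intro h
    rw [← divDiff_schubert_of_descent hw hj, h, divDiff_zero] at ih
    exact ih rfl

lemma exists_isHomogeneous_schubert {w : Equiv.Perm ℕ} (hw : IsFinPerm w) :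
    ∃ d, (Schubert w).IsHomogeneous d := by
  obtain ⟨n, hn⟩ := hw
  rw [schubert_eq_levelSchubert hn]
  refine descentFamily_induction (P := fun f : MvPolynomial ℕ ℤ => ∃ d, f.IsHomogeneous d)
    ⟨_, IsHomogeneous.prod _ _ _ fun i _ => isHomogeneous_X_pow i _⟩
    ?_ _
  rintro j f ⟨_ | d, hd⟩
  · exact ⟨0, by rw [divDiff_eq_zero_of_isHomogeneous_zero j hd]; exact isHomogeneous_zero ..⟩
  · exact ⟨d, isHomogeneous_divDiff j d f hd⟩

lemma constantCoeff_schubert {w : Equiv.Perm ℕ} (hw : IsFinPerm w) (h1 : w ≠ 1) :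
    constantCoeff (Schubert w) = 0 := by
  obtain ⟨d, hd⟩ := exists_isHomogeneous_schubert hw
  obtain ⟨j, hj⟩ := exists_descent h1
  rw [constantCoeff_eq]
  refine hd.coeff_eq_zero fun h => schubert_ne_zero (hw.mul_swap j (j + 1)) ?_
  rw [map_zero] at h
  subst h
  rw [← divDiff_schubert_of_descent hw hj, divDiff_eq_zero_of_isHomogeneous_zero j hd]

end SchubertPolynomials

section Coefficients

/-- The functional `f ↦ (∂_w f)(0)`, which extracts the coefficient of `𝔖_w`. -/
noncomputable def schubertCoord (w : Equiv.Perm ℕ) : MvPolynomial ℕ ℤ →ₗ[ℤ] ℤ :=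
  descentFamily (fun j L => L ∘ₗ divDiffₗ j) (lcoeff ℤ 0) w

lemma schubertCoord_one (f : MvPolynomial ℕ ℤ) : schubertCoord 1 f = constantCoeff f := by
  rw [schubertCoord, descentFamily_one]
  rfl

lemma schubertCoord_of_descent {w : Equiv.Perm ℕ} (hw : IsFinPerm w) {j : ℕ}
    (hj : w (j + 1) < w j) (f : MvPolynomial ℕ ℤ) :
    schubertCoord w f = schubertCoord (w * Equiv.swap j (j + 1)) (divDiff j f) := by
  rw [schubertCoord, descentFamily_eq _ _ _ hw hj]
  · rfl
  · intro i j hij L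
    refine LinearMap.ext fun f => ?_
    exact congrArg L (divDiff_comm hij f).symm
  · intro i L
    refine LinearMap.ext fun f => ?_
    exact congrArg L (divDiff_braid i f)

lemma schubertCoord_divDiff_of_descent {w : Equiv.Perm ℕ} (hw : IsFinPerm w) {j : ℕ}
    (hj : w (j + 1) < w j) (f : MvPolynomial ℕ ℤ) : schubertCoord w (divDiff j f) = 0 := by
  rw [schubertCoord_of_descent hw hj, divDiff_divDiff, map_zero]

lemma schubertCoord_divDiff_of_ascent {w : Equiv.Perm ℕ} (hw : IsFinPerm w) {j : ℕ}
    (hj : w j < w (j + 1)) (f : MvPolynomial ℕ ℤ) :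
    schubertCoord w (divDiff j f) = schubertCoord (w * Equiv.swap j (j + 1)) f := by
  rw [schubertCoord_of_descent (hw.mul_swap _ _) (j := j) (by simpa using hj), mul_assoc,
    Equiv.swap_mul_self, mul_one]

lemma schubertCoord_schubert {w u : Equiv.Perm ℕ} (hw : IsFinPerm w) (hu : IsFinPerm u) :
    schubertCoord w (Schubert u) = if u = w then 1 else 0 := by
  induction hw using IsFinPerm.descent_induction generalizing u with
  | one =>
    rw [schubertCoord_one]
    split_ifs with h
    · rw [h, schubert_one, map_one]
    · exact constantCoeff_schubert hu h
  | step w hw j hj ih =>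
    rw [schubertCoord_of_descent hw hj]
    by_cases h : u (j + 1) < u j
    · rw [divDiff_schubert_of_descent hu h, ih (hu.mul_swap _ _)]
      simp
    · rw [divDiff_schubert_of_ascent hu (not_descent_iff.1 h), map_zero, if_neg]
      rintro rfl
      exact h hj

lemma IsSchubertCoeff.apply_eq {u v w : Equiv.Perm ℕ} {c : Equiv.Perm ℕ →₀ ℕ}
    (hc : IsSchubertCoeff u v c) (hw : IsFinPerm w) :
    (c w : ℤ) = schubertCoord w (Schubert u * Schubert v) := by
  rw [hc.2, Finsupp.sum, map_sum]
  have h : ∀ x ∈ c.support, schubertCoord w ((c x : MvPolynomial ℕ ℤ) * Schubert x) =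
      if x = w then (c x : ℤ) else 0 := by
    intro x hx
    rw [← nsmul_eq_mul, map_nsmul, schubertCoord_schubert hw (hc.1 x hx)]
    simp
  rw [Finset.sum_congr rfl h, Finset.sum_ite_eq']
  split_ifs with h
  · rfl
  · simpa using h

lemma schubertCoord_X_mul_eq_zero {w : Equiv.Perm ℕ} (hw : IsFinPerm w) (i : ℕ)
    (f : MvPolynomial ℕ ℤ)
    (hf : ∀ u a b, IsFinPerm u → a < b → u a < u b → (i = a ∨ i = b) → w = u * Equiv.swap a b →
      schubertCoord u f = 0) : schubertCoord w (X i * f) = 0 := by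
  induction hw using IsFinPerm.descent_induction generalizing i f with
  | one => simp [schubertCoord_one]
  | step w hw j hj ih =>
    have hf' : i = j ∨ i = j + 1 → schubertCoord (w * Equiv.swap j (j + 1)) f = 0 := fun hi =>
      hf _ j (j + 1) (hw.mul_swap _ _) (Nat.lt_succ_self j) (by simpa using hj) hi
        (by rw [mul_assoc, Equiv.swap_mul_self, mul_one])
    have h₁ : schubertCoord (w * Equiv.swap j (j + 1)) (divDiff j (X i) * f) = 0 := by
      rcases eq_or_ne i j with rfl | hne
      · rw [divDiff_X_self, one_mul, hf' (Or.inl rfl)]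
      rcases eq_or_ne i (j + 1) with rfl | hne'
      · rw [divDiff_X_succ, neg_one_mul, map_neg, hf' (Or.inr rfl), neg_zero]
      · rw [divDiff_X_of_ne hne hne', zero_mul, map_zero]
    rw [schubertCoord_of_descent hw hj, divDiff_mul, rename_X, map_add, h₁, zero_add]
    refine ih _ _ fun u a b hu hab hlt hi hwu => ?_
    by_cases hdes : u (j + 1) < u j
    · exact schubertCoord_divDiff_of_descent hu hdes f
    have hasc := not_descent_iff.1 hdes
    rw [schubertCoord_divDiff_of_ascent hu hasc]
    have hw' : w = u * Equiv.swap a b * Equiv.swap j (j + 1) := by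
      rw [← hwu, mul_assoc, Equiv.swap_mul_self, mul_one]
    have hne : ¬ (a = j ∧ b = j + 1) := by
      rintro ⟨rfl, rfl⟩
      rw [hw', mul_assoc, Equiv.swap_mul_self, mul_one] at hj
      omega
    refine hf _ (Equiv.swap j (j + 1) a) (Equiv.swap j (j + 1) b) (hu.mul_swap _ _) ?_ ?_ ?_ ?_
    · simp only [Equiv.swap_apply_def]
      grind
    · simpa using hlt
    · rcases hi with rfl | rfl <;> simp
    · rw [hw', mul_assoc, mul_assoc, Equiv.mul_swap_eq_swap_mul (Equiv.swap j (j + 1))]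
      simp

lemma schubertCoord_mul_eq_zero_of_mem_supported {k : ℕ} {g : MvPolynomial ℕ ℤ}
    (hg : g ∈ supported ℤ (Set.Iio k)) {w : Equiv.Perm ℕ} (hw : IsFinPerm w)
    {f : MvPolynomial ℕ ℤ}
    (hf : ∀ u, IsFinPerm u → (∀ p, k ≤ p → w p ≤ u p) → schubertCoord u f = 0) :
    schubertCoord w (g * f) = 0 := by
  rw [supported_eq_adjoin_X] at hg
  induction hg using Algebra.adjoin_induction generalizing w f with
  | mem x hx =>
    obtain ⟨i, hi, rfl⟩ := hx
    rw [Set.mem_Iio] at hi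
    refine schubertCoord_X_mul_eq_zero hw i f fun u a b hu hab hlt hiab hwu => hf u hu ?_
    intro p hp
    rw [hwu, Equiv.Perm.mul_apply, Equiv.swap_apply_def]
    split_ifs with h1 h2
    · omega
    · rw [h2]
      exact hlt.le
    · exact le_rfl
  | algebraMap r =>
    rw [← Algebra.smul_def, map_smul, hf w hw fun _ _ => le_rfl, smul_zero]
  | add x y _ _ hx hy => rw [add_mul, map_add, hx hw hf, hy hw hf, add_zero]
  | mul x y _ _ hx hy =>
    rw [mul_assoc]
    exact hx hw fun u hu hwu => hy hu fun v hv huv =>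
      hf v hv fun p hp => (hwu p hp).trans (huv p hp)

lemma mem_supported_of_divDiff_eq_zero {k : ℕ} {g : MvPolynomial ℕ ℤ}
    (hg : ∀ j, k ≤ j → divDiff j g = 0) : g ∈ supported ℤ (Set.Iio k) := by
  have hstep : ∀ j, k ≤ j → j ∈ g.vars → j + 1 ∈ g.vars := by
    intro j hj hmem
    have hren : rename (Equiv.swap j (j + 1)) g = g := by
      rw [rename_eq_sub, hg j hj, mul_zero, sub_zero]
    rw [← hren] at hmem
    obtain ⟨m, hm, hmj⟩ := mem_vars_rename _ _ hmem
    rw [Equiv.swap_apply_eq_iff, Equiv.swap_apply_left] at hmj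
    rwa [← hmj]
  rw [mem_supported]
  intro j hj
  by_contra hlt
  rw [Set.mem_Iio, not_lt] at hlt
  have hall : ∀ d, j + d ∈ g.vars := by
    intro d
    induction d with
    | zero => exact hj
    | succ d ih => exact hstep _ (Nat.le_add_right_of_le hlt) ih
  exact (Set.infinite_range_of_injective (add_right_injective j))
    (g.vars.finite_toSet.subset (Set.range_subset_iff.2 hall))

/-- The instance of Monk's rule for `u t_{m,m+2}` with `u (m + 1) < u m < u (m + 2)`. -/
lemma schubertCoord_simple_mul_schubert {u : Equiv.Perm ℕ} (hu : IsFinPerm u) {m : ℕ}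
    (h₁ : u (m + 1) < u m) (h₂ : u m < u (m + 2)) :
    schubertCoord (u * Equiv.swap m (m + 2))
      (Schubert (Equiv.swap m (m + 1)) * Schubert u) = 1 := by
  have hs : IsFinPerm (Equiv.swap m (m + 1)) := one_mul (Equiv.swap m (m + 1)) ▸
    isFinPerm_one.mul_swap m (m + 1)
  have e1 : Equiv.swap m (m + 1) (m + 2) = m + 2 :=
    Equiv.swap_apply_of_ne_of_ne (by omega) (by omega)
  have e2 : Equiv.swap m (m + 2) (m + 1) = m + 1 :=
    Equiv.swap_apply_of_ne_of_ne (by omega) (by omega)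
  have hw : IsFinPerm (u * Equiv.swap m (m + 2)) := hu.mul_swap _ _
  have hself : divDiff m (Schubert (Equiv.swap m (m + 1))) = 1 := by
    rw [divDiff_schubert_of_descent hs (by simp), Equiv.swap_mul_self, schubert_one]
  have hnext : divDiff (m + 1) (Schubert (Equiv.swap m (m + 1))) = 0 :=
    divDiff_schubert_of_ascent hs (by simp [add_assoc, e1])
  rw [schubertCoord_of_descent hw (j := m) (by simp [e2]; omega), divDiff_mul, map_add, hself,
    one_mul, schubertCoord_schubert (hw.mul_swap _ _) hu, if_neg, zero_add,
    divDiff_schubert_of_descent hu h₁,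
    schubertCoord_of_descent (hw.mul_swap _ _) (j := m + 1) (by simp [add_assoc, e1, h₂]),
    divDiff_mul, divDiff_schubert_of_ascent (hu.mul_swap _ _) (j := m + 1)
      (by simp [add_assoc, e1, h₂]), mul_zero, add_zero, rename_eq_sub, hself, divDiff_sub, hnext,
    mul_one, divDiff_sub, divDiff_X_of_ne (by omega) (by omega), divDiff_X_self, zero_sub, zero_sub,
    neg_neg, one_mul, schubertCoord_schubert ((hw.mul_swap _ _).mul_swap _ _) (hu.mul_swap _ _),
    if_pos]
  · rw [mul_assoc, mul_assoc]
    congr 1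
    ext x
    simp only [Equiv.Perm.mul_apply, Equiv.swap_apply_def]
    grind
  · intro h
    have := congrArg (fun σ : Equiv.Perm ℕ => σ m) h
    simp [e2] at this

end Coefficients

section LehmerCodes

lemma finite_lCode (w : Equiv.Perm ℕ) (i : ℕ) : {j | i < j ∧ w j < w i}.Finite :=
  ((Set.finite_Iio (w i)).preimage w.injective.injOn).subset fun _ h => h.2

lemma lCode_eq_zero_iff {w : Equiv.Perm ℕ} {i : ℕ} :
    lCode w i = 0 ↔ ∀ j, i < j → w i < w j := by
  rw [lCode, Set.ncard_eq_zero (finite_lCode w i), Set.eq_empty_iff_forall_notMem]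
  refine forall_congr' fun j => ?_
  simp only [Set.mem_ofPred_eq, not_and, not_lt]
  exact ⟨fun h hij => (h hij).lt_of_ne fun e => hij.ne (w.injective e), fun h hij => (h hij).le⟩

lemma lCode_pos {w : Equiv.Perm ℕ} {i j : ℕ} (hij : i < j) (h : w j < w i) : 0 < lCode w i :=
  (Set.ncard_pos (finite_lCode w i)).2 ⟨j, hij, h⟩

lemma exists_of_lCode_pos {w : Equiv.Perm ℕ} {i : ℕ} (h : 0 < lCode w i) :
    ∃ j, i < j ∧ w j < w i :=
  (Set.ncard_pos (finite_lCode w i)).1 h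

lemma IsCodeScale.apply_lt_apply {N : ℕ} {w w' : Equiv.Perm ℕ} (h : IsCodeScale N w w') {i : ℕ}
    (hi : ∀ j, i < j → w i < w j) : ∀ j, i < j → w' i < w' j := by
  rw [← lCode_eq_zero_iff] at hi ⊢
  rw [h.2, hi, mul_zero]

/-- If `w` has code at least two at every position `< p`, code zero at `p + 2` and
`w (p + 2) < w (p + 1)`, then `w (p + 2) ≤ 1`. -/
lemma apply_add_two_le_one {w : Equiv.Perm ℕ} {p : ℕ} (hcode : ∀ j, j < p → 1 < lCode w j)
    (hdes : w (p + 2) < w (p + 1)) (hzero : ∀ j, p + 2 < j → w (p + 2) < w j) :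
    w (p + 2) ≤ 1 := by
  have hlow : ∀ j, w j < w (p + 2) → j = p := by
    by_contra! H
    obtain ⟨j, hj, hjp⟩ := H
    have hlt : ∀ j, w j < w (p + 2) → j ≠ p → j < p := by
      intro j hj hjp
      have h1 : ¬ p + 2 < j := fun h => absurd (hzero j h) (by omega)
      have h2 : j ≠ p + 2 := by rintro rfl; omega
      have h3 : j ≠ p + 1 := by rintro rfl; omega
      omega
    obtain ⟨m, hm, hmin⟩ := Finset.exists_min_image (Finset.range p) w
      ⟨j, Finset.mem_range.2 (hlt j hj hjp)⟩
    have hmj := hmin j (Finset.mem_range.2 (hlt j hj hjp))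
    refine absurd (hcode m (Finset.mem_range.1 hm)) (not_lt.2 ?_)
    rw [lCode, ← Set.ncard_singleton p]
    refine Set.ncard_le_ncard ?_
    rintro x ⟨_, hx⟩
    by_contra hxp
    have := hmin x (Finset.mem_range.2 (hlt x (by omega) hxp))
    omega
  by_contra! h
  have h0 := hlow (w.symm 0) (by simp; omega)
  have h1 := hlow (w.symm 1) (by simpa using h)
  simpa using h0.trans h1.symm

end LehmerCodes

/-- Corollary 1.4: explicit counterexamples to Kirillov's saturation conjecture, for
`u = (2,3,…,n−2,1,n,n−1)`, `v = s_{n−3}` and `w = u·t_{n−3,n−1}` (all written 0-indexed). -/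
theorem kirillov_counterexample
    (n : ℕ) (hn : 4 ≤ n) (u w : Equiv.Perm ℕ)
    (hu1 : ∀ m, m + 4 ≤ n → u m = m + 1)
    (hu2 : u (n - 3) = 0) (hu3 : u (n - 2) = n - 1) (hu4 : u (n - 1) = n - 2)
    (hu5 : InSymm n u)
    (hw1 : ∀ m, m + 5 ≤ n → w m = m + 1)
    (hw2 : w (n - 4) = n - 1) (hw3 : w (n - 3) = 0) (hw4 : w (n - 2) = n - 3)
    (hw5 : w (n - 1) = n - 2) (hw6 : InSymm n w) :
    (∀ c : Equiv.Perm ℕ →₀ ℕ, IsSchubertCoeff u (Equiv.swap (n - 4) (n - 3)) c →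
      c w = 1) ∧
    (∀ N : ℕ, 1 < N → ∀ u' v' w' : Equiv.Perm ℕ,
      IsCodeScale N u u' → IsCodeScale N (Equiv.swap (n - 4) (n - 3)) v' →
      IsCodeScale N w w' →
      ∀ c : Equiv.Perm ℕ →₀ ℕ, IsSchubertCoeff u' v' c → c w' = 0) := by
  obtain ⟨m, rfl⟩ := Nat.exists_eq_add_of_le' hn
  simp only [Nat.add_sub_cancel, show m + 4 - 1 = m + 3 from rfl,
    show m + 4 - 2 = m + 2 from rfl, show m + 4 - 3 = m + 1 from rfl] at hu2 hu3 hu4 hw2 hw3 hw4 hw5 ⊢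
  have hum := hu1 m le_rfl
  have hu_fin : IsFinPerm u := ⟨_, hu5⟩
  have hw_fin : IsFinPerm w := ⟨_, hw6⟩
  refine ⟨fun c hc => ?_, fun N hN u' v' w' hu' hv' hw' c hc => ?_⟩
  · have hwu : w = u * Equiv.swap m (m + 2) := by
      ext x
      rw [Equiv.Perm.mul_apply, Equiv.swap_apply_def]
      have hx : x < m ∨ x = m ∨ x = m + 1 ∨ x = m + 2 ∨ x = m + 3 ∨ m + 4 ≤ x := by omega
      rcases hx with h | rfl | rfl | rfl | rfl | h
      · rw [if_neg (by omega), if_neg (by omega), hu1 x (by omega), hw1 x (by omega)]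
      · simp [hw2, hu3]
      · simp [hw3, hu2]
      · simp [hw4, hum]
      · simp [hw5, hu4]
      · rw [if_neg (by omega), if_neg (by omega), hu5 x h, hw6 x h]
    have h := hc.apply_eq hw_fin
    rw [mul_comm, hwu, schubertCoord_simple_mul_schubert hu_fin (by omega) (by omega)] at h
    rw [hwu]
    exact_mod_cast h
  · have hcoord := hc.apply_eq hw'.1
    have hu_le : u' (m + 3) ≤ 1 := by
      have hpos : 0 < lCode u (m + 2) := lCode_pos (j := m + 3) (by omega) (by omega)
      have hzero : ∀ j, m + 3 < j → u' (m + 3) < u' j :=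
        hu'.apply_lt_apply fun j hj => by
          rw [hu5 j (by omega), hu4]
          omega
      refine apply_add_two_le_one (p := m + 1) (fun j hj => ?_) ?_ hzero
      · rw [hu'.2]
        have : 0 < lCode u j := lCode_pos hj (by rw [hu2, hu1 j (by omega)]; omega)
        nlinarith
      · obtain ⟨j, hj, hlt⟩ := exists_of_lCode_pos (w := u') (i := m + 2)
          (by rw [hu'.2]; positivity)
        rcases (Nat.succ_le_of_lt hj).eq_or_lt with rfl | hj'
        · exact hlt
        · exact (hzero j hj').trans hlt
    have hw_ge : 1 < w' (m + 3) := by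
      have h1 : w' (m + 1) < w' (m + 2) := by
        refine hw'.apply_lt_apply (fun j hj => ?_) _ (Nat.lt_succ_self _)
        rw [hw3, Nat.pos_iff_ne_zero, ← hw3]
        exact fun e => hj.ne' (w.injective e)
      have h2 : w' (m + 2) < w' (m + 3) := by
        refine hw'.apply_lt_apply (fun j hj => ?_) _ (Nat.lt_succ_self _)
        rcases (Nat.succ_le_of_lt hj).eq_or_lt with rfl | hj'
        · rw [hw4, Nat.succ_eq_add_one, hw5]
          omega
        · rw [hw4, hw6 j hj']
          omega
      omega
    have hv : Schubert v' ∈ supported ℤ (Set.Iio (m + 1)) := by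
      refine mem_supported_of_divDiff_eq_zero fun j hj =>
        divDiff_schubert_of_ascent hv'.1 (hv'.apply_lt_apply (fun i hi => ?_) _ (Nat.lt_succ_self j))
      simp only [Equiv.swap_apply_def]
      grind
    rw [mul_comm, schubertCoord_mul_eq_zero_of_mem_supported hv hw'.1] at hcoord
    · exact_mod_cast hcoord
    · intro x hx hle
      rw [schubertCoord_schubert hx hu'.1, if_neg]
      rintro rfl
      have := hle (m + 3) (by omega)
      omega
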